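/- arXiv:2508.16462 — 8 statements merged into one kernel-verified Lean document; each statement's English description precedes it below -/
import Mathlib

section
/- The problem (P) is Tykhonov well-posed in the extended sense if and only if it is weakly Tykhonov well-posed in the extended sense and the set argmin(P) is compact. -/
open Metric Filter Topology Set ENNReal Bornology

noncomputable section

/-- The set of globally optimal solutions of problem (P):
minimize `f x` subject to `x ∈ M` and `x ∈ Q`, where `fstar` is the optimal value. -/
def argminP {X : Type*} (M Q : Set X) (f : X → EReal) (fstar : ℝ) : Set X :=
  {x | x ∈ M ∩ Q ∧ f x = (fstar : EReal)}

/-- `phi` is a penalty term (infeasibility measure) for the constraint `x ∈ M` on `Q`. -/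
def IsPenaltyTerm {X : Type*} (M Q : Set X) (phi : X → ℝ≥0∞) : Prop :=
  ∀ x ∈ Q, (phi x = 0 ↔ x ∈ M)

/-- The penalty function `F_c x = f x + c * phi x`. -/
def Pen {X : Type*} (f : X → EReal) (phi : X → ℝ≥0∞) (c : ℝ) (x : X) : EReal :=
  f x + (c : EReal) * (phi x : EReal)

/-- Some subsequence of `x` converges to a point of `S`. -/
def HasSubseqConvTo {X : Type*} [MetricSpace X] (x : ℕ → X) (S : Set X) : Prop :=
  ∃ (σ : ℕ → ℕ) (p : X), StrictMono σ ∧ p ∈ S ∧ Tendsto (fun k => x (σ k)) atTop (𝓝 p)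

/-- Problem (P) is Tykhonov well-posed in the extended sense. -/
def TykhonovWPExt {X : Type*} [MetricSpace X] (M Q : Set X) (f : X → EReal) (fstar : ℝ) :
    Prop :=
  (argminP M Q f fstar).Nonempty ∧
    ∀ x : ℕ → X, (∀ n, x n ∈ M ∩ Q) →
      Tendsto (fun n => f (x n)) atTop (𝓝 (fstar : EReal)) →
      HasSubseqConvTo x (argminP M Q f fstar)

/-- Problem (P) is weakly Tykhonov well-posed in the extended sense. -/
def WeakTykhonovWPExt {X : Type*} [MetricSpace X] (M Q : Set X) (f : X → EReal) (fstar : ℝ) :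
    Prop :=
  (argminP M Q f fstar).Nonempty ∧
    ∀ x : ℕ → X, (∀ n, x n ∈ M ∩ Q) →
      Tendsto (fun n => f (x n)) atTop (𝓝 (fstar : EReal)) →
      Tendsto (fun n => infDist (x n) (argminP M Q f fstar)) atTop (𝓝 0)

/-- Problem (P) is Levitin-Polyak well-posed in the extended sense. -/
def LevitinPolyakWPExt {X : Type*} [MetricSpace X] (M Q : Set X) (f : X → EReal) (fstar : ℝ) :
    Prop :=
  (argminP M Q f fstar).Nonempty ∧
    ∀ x : ℕ → X,
      Tendsto (fun n => f (x n)) atTop (𝓝 (fstar : EReal)) →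
      Tendsto (fun n => infDist (x n) (M ∩ Q)) atTop (𝓝 0) →
      HasSubseqConvTo x (argminP M Q f fstar)

/-- Problem (P) is weakly Levitin-Polyak well-posed in the extended sense. -/
def WeakLevitinPolyakWPExt {X : Type*} [MetricSpace X] (M Q : Set X) (f : X → EReal)
    (fstar : ℝ) : Prop :=
  (argminP M Q f fstar).Nonempty ∧
    ∀ x : ℕ → X,
      Tendsto (fun n => f (x n)) atTop (𝓝 (fstar : EReal)) →
      Tendsto (fun n => infDist (x n) (M ∩ Q)) atTop (𝓝 0) →
      Tendsto (fun n => infDist (x n) (argminP M Q f fstar)) atTop (𝓝 0)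

/-- Problem (P) is Levitin-Polyak well-posed with respect to the infeasibility measure `phi`. -/
def LevitinPolyakWPwrt {X : Type*} [MetricSpace X] (M Q : Set X) (f : X → EReal)
    (phi : X → ℝ≥0∞) (fstar : ℝ) : Prop :=
  (argminP M Q f fstar).Nonempty ∧
    ∀ x : ℕ → X,
      Tendsto (fun n => f (x n)) atTop (𝓝 (fstar : EReal)) →
      Tendsto (fun n => phi (x n)) atTop (𝓝 (0 : ℝ≥0∞)) →
      HasSubseqConvTo x (argminP M Q f fstar)

/-- Problem (P) is weakly Levitin-Polyak well-posed with respect to the infeasibility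
measure `phi`. -/
def WeakLevitinPolyakWPwrt {X : Type*} [MetricSpace X] (M Q : Set X) (f : X → EReal)
    (phi : X → ℝ≥0∞) (fstar : ℝ) : Prop :=
  (argminP M Q f fstar).Nonempty ∧
    ∀ x : ℕ → X,
      Tendsto (fun n => f (x n)) atTop (𝓝 (fstar : EReal)) →
      Tendsto (fun n => phi (x n)) atTop (𝓝 (0 : ℝ≥0∞)) →
      Tendsto (fun n => infDist (x n) (argminP M Q f fstar)) atTop (𝓝 0)

/-- If `x` has a subsequence converging to a point of `S`, then along it the distance to `S`
tends to zero. -/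
theorem HasSubseqConvTo.exists_tendsto_infDist {X : Type*} [MetricSpace X] {x : ℕ → X}
    {S : Set X} (h : HasSubseqConvTo x S) :
    ∃ σ : ℕ → ℕ, Tendsto (fun k => infDist (x (σ k)) S) atTop (𝓝 0) := by
  obtain ⟨σ, p, -, hp, hlim⟩ := h
  refine ⟨σ, ?_⟩
  rw [← infDist_zero_of_mem hp]
  exact ((continuous_infDist_pt S).tendsto p).comp hlim

/-- A sequence whose distance to a nonempty compact set tends to zero has a subsequence
converging to a point of that set. -/
theorem IsCompact.hasSubseqConvTo {X : Type*} [MetricSpace X] {x : ℕ → X} {S : Set X}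
    (hS : IsCompact S) (hne : S.Nonempty)
    (hx : Tendsto (fun n => infDist (x n) S) atTop (𝓝 0)) : HasSubseqConvTo x S := by
  choose y hyS hy using fun n => hS.exists_infDist_eq_dist hne (x n)
  obtain ⟨p, hp, σ, hσ, hlim⟩ := hS.tendsto_subseq hyS
  refine ⟨σ, p, hσ, hp, hlim.congr_dist ?_⟩
  simpa only [Function.comp_def, hy, dist_comm] using hx.comp hσ.tendsto_atTop

theorem TykhonovWPExt.weakTykhonovWPExt {X : Type*} [MetricSpace X] {M Q : Set X}
    {f : X → EReal} {fstar : ℝ} (h : TykhonovWPExt M Q f fstar) :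
    WeakTykhonovWPExt M Q f fstar :=
  ⟨h.1, fun x hx hf => tendsto_of_subseq_tendsto fun ns hns =>
    (h.2 (fun n => x (ns n)) (fun n => hx (ns n)) (hf.comp hns)).exists_tendsto_infDist⟩

theorem TykhonovWPExt.isCompact_argminP {X : Type*} [MetricSpace X] {M Q : Set X}
    {f : X → EReal} {fstar : ℝ} (h : TykhonovWPExt M Q f fstar) :
    IsCompact (argminP M Q f fstar) := by
  refine IsSeqCompact.isCompact fun x hx => ?_
  obtain ⟨σ, p, hσ, hp, hlim⟩ := h.2 x (fun n => (hx n).1)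
    (tendsto_const_nhds.congr fun n => (hx n).2.symm)
  exact ⟨p, hp, σ, hσ, hlim⟩

/-- (P) is Tykhonov well-posed in the extended sense iff it is weakly
Tykhonov well-posed in the extended sense and `argmin(P)` is compact. -/
theorem stmt1 {X : Type*} [MetricSpace X] (M Q : Set X) (f : X → EReal) (fstar : ℝ)
    (hM : M.Nonempty) (hQ : Q.Nonempty) (hfeas : (M ∩ Q).Nonempty)
    (hopt : (⨅ x ∈ M ∩ Q, f x) = (fstar : EReal)) :
    TykhonovWPExt M Q f fstar ↔
      WeakTykhonovWPExt M Q f fstar ∧ IsCompact (argminP M Q f fstar) :=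
  ⟨fun h => ⟨h.weakTykhonovWPExt, h.isCompact_argminP⟩,
    fun ⟨h, hS⟩ => ⟨h.1, fun x hx hf => hS.hasSubseqConvTo h.1 (h.2 x hx hf)⟩⟩
end
end

section
/- Let X be a real normed space, let f be uniformly continuous on bounded sets, and let the feasible set Ω be bounded. Then the problem (P) is Levitin-Polyak well-posed in the extended sense if and only if it is Tykhonov well-posed in the extended sense, and (P) is weakly Levitin-Polyak well-posed in the extended sense if and only if it is weakly Tykhonov well-posed in the extended sense. -/
open Metric Filter Topology Set ENNReal Bornology

noncomputable section

/-- `x` converges weakly to `p` (i.e. `l (x n) → l p` for every continuous linear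
functional `l`). -/
def WeakSeqConv {X : Type*} [NormedAddCommGroup X] [NormedSpace ℝ X] (x : ℕ → X) (p : X) :
    Prop :=
  ∀ l : X →L[ℝ] ℝ, Tendsto (fun n => l (x n)) atTop (𝓝 (l p))

/-- `Q` is weakly sequentially closed. -/
def WeaklySeqClosed {X : Type*} [NormedAddCommGroup X] [NormedSpace ℝ X] (Q : Set X) :
    Prop :=
  ∀ (x : ℕ → X) (p : X), (∀ n, x n ∈ Q) → WeakSeqConv x p → p ∈ Q

/-- `g` is weakly sequentially lower semicontinuous on `Q`. -/
def WeaklySeqLSCOn {X : Type*} [NormedAddCommGroup X] [NormedSpace ℝ X] {E : Type*}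
    [CompleteLattice E] (g : X → E) (Q : Set X) : Prop :=
  ∀ (x : ℕ → X) (p : X), (∀ n, x n ∈ Q) → p ∈ Q → WeakSeqConv x p →
    g p ≤ Filter.liminf (fun n => g (x n)) atTop

/-- `g` is weakly sequentially lower semicontinuous. -/
def WeaklySeqLSC {X : Type*} [NormedAddCommGroup X] [NormedSpace ℝ X] {E : Type*}
    [CompleteLattice E] (g : X → E) : Prop :=
  ∀ (x : ℕ → X) (p : X), WeakSeqConv x p →
    g p ≤ Filter.liminf (fun n => g (x n)) atTop

/-- Sequential characterization (Eberlein–Šmulian) of reflexivity of a Banach space: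
every bounded sequence has a weakly convergent subsequence. -/
def ReflexiveSeq (X : Type*) [NormedAddCommGroup X] [NormedSpace ℝ X] : Prop :=
  ∀ x : ℕ → X, IsBounded (Set.range x) →
    ∃ (σ : ℕ → ℕ) (p : X), StrictMono σ ∧ WeakSeqConv (fun k => x (σ k)) p

/-- `F_c` is strongly non-degenerate. -/
def StronglyNondegenerate {X : Type*} [NormedAddCommGroup X] (M Q : Set X) (f : X → EReal)
    (phi : X → ℝ≥0∞) : Prop :=
  ∃ cs : ℝ, 0 ≤ cs ∧ ∃ xc : ℝ → X,
    (∀ c ≥ cs, xc c ∈ Q ∧ ∀ y ∈ Q, Pen f phi c (xc c) ≤ Pen f phi c y) ∧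
    IsBounded (xc '' Ici cs) ∧
    Tendsto (fun c => infDist (xc c) (M ∩ Q)) atTop (𝓝 0)

/-- `f` is uniformly continuous on bounded sets (for an extended-real-valued `f`). -/
def UnifContOnBddEReal {X : Type*} [NormedAddCommGroup X] (f : X → EReal) : Prop :=
  ∀ s : Set X, IsBounded s → ∀ ε : ℝ, 0 < ε →
    ∃ δ > (0 : ℝ), ∀ x ∈ s, ∀ y ∈ s, dist x y < δ → f x ≤ f y + (ε : EReal)

/-- A sequence whose distance to a nonempty set `s` tends to zero is asymptotic to a sequence
in `s`. -/
theorem exists_seq_mem_tendsto_dist {X : Type*} [PseudoMetricSpace X] {s : Set X}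
    (hs : s.Nonempty) {x : ℕ → X} (hx : Tendsto (fun n => infDist (x n) s) atTop (𝓝 0)) :
    ∃ y : ℕ → X, (∀ n, y n ∈ s) ∧ Tendsto (fun n => dist (x n) (y n)) atTop (𝓝 0) := by
  have h (n : ℕ) : ∃ y ∈ s, dist (x n) y < infDist (x n) s + 1 / ((n : ℝ) + 1) :=
    (infDist_lt_iff hs).1 (lt_add_of_pos_right _ Nat.one_div_pos_of_nat)
  choose y hys hy using h
  refine ⟨y, hys, squeeze_zero (fun _ => dist_nonneg) (fun n => (hy n).le) ?_⟩
  simpa using hx.add tendsto_one_div_add_atTop_nhds_zero_nat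

/-- If `f` is uniformly continuous on bounded sets, then a sequence in a bounded set that is
asymptotic to a minimizing sequence is itself minimizing. -/
theorem UnifContOnBddEReal.tendsto_of_tendsto_dist {X : Type*} [NormedAddCommGroup X]
    {f : X → EReal} (hf : UnifContOnBddEReal f) {s : Set X} (hs : IsBounded s) {a : ℝ}
    (ha : ∀ z ∈ s, (a : EReal) ≤ f z) {x y : ℕ → X} (hy : ∀ n, y n ∈ s)
    (hxy : Tendsto (fun n => dist (x n) (y n)) atTop (𝓝 0))
    (hfx : Tendsto (fun n => f (x n)) atTop (𝓝 (a : EReal))) :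
    Tendsto (fun n => f (y n)) atTop (𝓝 (a : EReal)) := by
  refine tendsto_order.2
    ⟨fun b hb => Eventually.of_forall fun n => hb.trans_le (ha _ (hy n)), fun b hb => ?_⟩
  obtain ⟨r, har, hrb⟩ := EReal.lt_iff_exists_real_btwn.1 hb
  have hε : 0 < (r - a) / 2 := half_pos (sub_pos.2 (EReal.coe_lt_coe_iff.1 har))
  obtain ⟨δ, hδ, hfδ⟩ := hf (thickening 1 s) hs.thickening _ hε
  have hax : (a : EReal) < ((a + (r - a) / 2 : ℝ) : EReal) :=
    EReal.coe_lt_coe_iff.2 (lt_add_of_pos_right a hε)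
  filter_upwards [hxy.eventually_lt_const hδ, hxy.eventually_lt_const one_pos,
    hfx.eventually_lt_const hax] with n hnδ hn1 hnf
  refine lt_of_le_of_lt ?_ hrb
  calc f (y n) ≤ f (x n) + (((r - a) / 2 : ℝ) : EReal) :=
        hfδ _ (self_subset_thickening one_pos s (hy n)) _
          (mem_thickening_iff.2 ⟨y n, hy n, hn1⟩) (by rwa [dist_comm])
    _ ≤ ((a + (r - a) / 2 : ℝ) : EReal) + (((r - a) / 2 : ℝ) : EReal) :=
        add_le_add hnf.le le_rfl
    _ = r := by
        rw [← EReal.coe_add]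
        congr 1
        ring

/-- A convergent subsequence of a sequence gives one of any asymptotic sequence. -/
theorem HasSubseqConvTo.of_tendsto_dist {X : Type*} [MetricSpace X] {x y : ℕ → X} {S : Set X}
    (h : HasSubseqConvTo y S) (hxy : Tendsto (fun n => dist (x n) (y n)) atTop (𝓝 0)) :
    HasSubseqConvTo x S := by
  obtain ⟨σ, p, hσ, hp, hlim⟩ := h
  refine ⟨σ, p, hσ, hp, (tendsto_iff_of_dist ?_).2 hlim⟩
  exact hxy.comp hσ.tendsto_atTop

/-- If `f` is uniformly continuous on bounded sets and `Ω` is bounded,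
then (weak) Levitin-Polyak well-posedness in the extended sense is equivalent to
(weak) Tykhonov well-posedness in the extended sense. -/
theorem stmt4 {X : Type*} [NormedAddCommGroup X] [NormedSpace ℝ X] (M Q : Set X)
    (f : X → EReal) (fstar : ℝ)
    (hM : M.Nonempty) (hQ : Q.Nonempty) (hfeas : (M ∩ Q).Nonempty)
    (hopt : (⨅ x ∈ M ∩ Q, f x) = (fstar : EReal))
    (hf : UnifContOnBddEReal f)
    (hΩbdd : IsBounded (M ∩ Q)) :
    (LevitinPolyakWPExt M Q f fstar ↔ TykhonovWPExt M Q f fstar) ∧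
      (WeakLevitinPolyakWPExt M Q f fstar ↔ WeakTykhonovWPExt M Q f fstar) := by
  have hlow : ∀ z ∈ M ∩ Q, (fstar : EReal) ≤ f z := fun z hz => hopt ▸ iInf₂_le z hz
  have hfeasible {x : ℕ → X} (hx : ∀ n, x n ∈ M ∩ Q) :
      Tendsto (fun n => infDist (x n) (M ∩ Q)) atTop (𝓝 0) := by
    simp [fun n => infDist_zero_of_mem (hx n)]
  refine ⟨⟨fun h => ⟨h.1, fun x hx hfx => h.2 x hfx (hfeasible hx)⟩, fun h => ⟨h.1, ?_⟩⟩,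
    ⟨fun h => ⟨h.1, fun x hx hfx => h.2 x hfx (hfeasible hx)⟩, fun h => ⟨h.1, ?_⟩⟩⟩
  all_goals
    intro x hfx hx
    obtain ⟨y, hy, hxy⟩ := exists_seq_mem_tendsto_dist hfeas hx
    have hTy := h.2 y hy (hf.tendsto_of_tendsto_dist hΩbdd hlow hy hxy hfx)
  · exact hTy.of_tendsto_dist hxy
  · refine squeeze_zero (fun _ => infDist_nonneg)
      (fun n => infDist_le_infDist_add_dist (y := y n)) ?_
    simpa using hTy.add hxy
end
end

section
/- Let X be a real normed space and let f be uniformly continuous on bounded sets. Suppose there exists a nondecreasing function ω : [0,+∞) → [0,+∞) such that (i) ω(t) = 0 if and only if t = 0, and (ii) f(x) + ω(dist(x, Ω)) → +∞ as ‖x‖ → +∞. Then the problem (P) is Levitin-Polyak well-posed in the extended sense if and only if it is Tykhonov well-posed in the extended sense, and (P) is weakly Levitin-Polyak well-posed in the extended sense if and only if it is weakly Tykhonov well-posed in the extended sense. -/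
open Metric Filter Topology Set ENNReal Bornology

noncomputable section

/-- A minimizing sequence that approaches the feasible region can be shadowed by a feasible
minimizing sequence, when `f` is uniformly continuous on bounded sets and
`f x + ω (dist (x, Ω))` is coercive. -/
lemma exists_feasible_minimizing_seq {X : Type*} [NormedAddCommGroup X] {Ω : Set X}
    {f : X → EReal} {fstar : ℝ} {ω : ℝ → ℝ} (hΩ : Ω.Nonempty)
    (hopt : (⨅ x ∈ Ω, f x) = (fstar : EReal)) (hf : UnifContOnBddEReal f)
    (hω : MonotoneOn ω (Ici 0))
    (hcoer : Tendsto (fun x : X => f x + ((ω (infDist x Ω) : ℝ) : EReal))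
      (comap norm atTop) (𝓝 (⊤ : EReal)))
    {x : ℕ → X} (hfx : Tendsto (fun n => f (x n)) atTop (𝓝 (fstar : EReal)))
    (hx : Tendsto (fun n => infDist (x n) Ω) atTop (𝓝 0)) :
    ∃ y : ℕ → X, (∀ n, y n ∈ Ω) ∧ Tendsto (fun n => f (y n)) atTop (𝓝 (fstar : EReal)) ∧
      Tendsto (fun n => dist (x n) (y n)) atTop (𝓝 0) := by
  have hnear (n : ℕ) : ∃ y ∈ Ω, dist (x n) y < infDist (x n) Ω + 1 / ((n : ℝ) + 1) :=
    (infDist_lt_iff hΩ).1 (lt_add_of_pos_right _ Nat.one_div_pos_of_nat)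
  choose y hyΩ hxy using hnear
  have hdist : Tendsto (fun n => dist (x n) (y n)) atTop (𝓝 0) := by
    refine squeeze_zero (fun _ => dist_nonneg) (fun n => (hxy n).le) ?_
    simpa using hx.add (tendsto_one_div_add_atTop_nhds_zero_nat (𝕜 := ℝ))
  obtain ⟨R, hR⟩ : ∃ R : ℝ, ∀ z : X, R ≤ ‖z‖ →
      ((fstar + 1 + ω 1 : ℝ) : EReal) < f z + ((ω (infDist z Ω) : ℝ) : EReal) := by
    obtain ⟨t, ht, hts⟩ := mem_comap.1 (hcoer.eventually (lt_mem_nhds (EReal.coe_lt_top _)))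
    obtain ⟨R, hR⟩ := mem_atTop_sets.1 ht
    exact ⟨R, fun z hz => hts (hR _ hz)⟩
  have hlt {ε : ℝ} (hε : 0 < ε) : ∀ᶠ n in atTop, f (x n) < ((fstar + ε : ℝ) : EReal) :=
    hfx.eventually (gt_mem_nhds (EReal.coe_lt_coe_iff.2 (lt_add_of_pos_right _ hε)))
  have hbdd : ∀ᶠ n in atTop, ‖x n‖ < R := by
    filter_upwards [hlt one_pos, hx.eventually (gt_mem_nhds one_pos)] with n hn hn'
    by_contra! hle
    refine (hR _ hle).not_ge ?_
    rw [EReal.coe_add]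
    exact add_le_add hn.le (EReal.coe_le_coe_iff.2
      (hω infDist_nonneg (mem_Ici.2 zero_le_one) hn'.le))
  refine ⟨y, hyΩ, tendsto_order.2 ⟨fun a ha => Eventually.of_forall fun n =>
    ha.trans_le (hopt ▸ iInf₂_le (y n) (hyΩ n)), fun a ha => ?_⟩, hdist⟩
  obtain ⟨r, hr, hra⟩ := EReal.lt_iff_exists_real_btwn.1 ha
  have hε : 0 < (r - fstar) / 2 := half_pos (sub_pos.2 (EReal.coe_lt_coe_iff.1 hr))
  obtain ⟨δ, hδ, hfδ⟩ := hf (ball 0 (R + 1)) isBounded_ball _ hε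
  filter_upwards [hlt hε, hbdd, hdist.eventually (gt_mem_nhds hδ),
    hdist.eventually (gt_mem_nhds one_pos)] with n hfn hn hnδ hn1
  have hyn : ‖y n‖ < R + 1 := by
    have := norm_le_norm_add_norm_sub (x n) (y n)
    rw [← dist_eq_norm] at this
    linarith
  calc f (y n) ≤ f (x n) + (((r - fstar) / 2 : ℝ) : EReal) :=
        hfδ _ (mem_ball_zero_iff.2 hyn) _ (mem_ball_zero_iff.2 (by linarith))
          (by rwa [dist_comm])
    _ ≤ ((fstar + (r - fstar) / 2 : ℝ) : EReal) + (((r - fstar) / 2 : ℝ) : EReal) :=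
        add_le_add_left hfn.le _
    _ = (r : EReal) := by rw [← EReal.coe_add]; congr 1; ring
    _ < a := hra

/-- A sequence asymptotic to one with a subsequence converging into `S` has such a subsequence. -/
lemma HasSubseqConvTo.of_dist {X : Type*} [MetricSpace X] {x y : ℕ → X} {S : Set X}
    (hy : HasSubseqConvTo y S) (h : Tendsto (fun n => dist (x n) (y n)) atTop (𝓝 0)) :
    HasSubseqConvTo x S := by
  obtain ⟨σ, p, hσ, hp, hlim⟩ := hy
  refine ⟨σ, p, hσ, hp, (tendsto_iff_of_dist ?_).2 hlim⟩
  exact h.comp hσ.tendsto_atTop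

/-- If `y` approaches `S` and `x` is asymptotic to `y`, then `x` approaches `S`. -/
lemma tendsto_infDist_zero_of_dist {X : Type*} [MetricSpace X] {x y : ℕ → X} {S : Set X}
    (hy : Tendsto (fun n => infDist (y n) S) atTop (𝓝 0))
    (h : Tendsto (fun n => dist (x n) (y n)) atTop (𝓝 0)) :
    Tendsto (fun n => infDist (x n) S) atTop (𝓝 0) :=
  squeeze_zero (fun _ => infDist_nonneg) (fun _ => infDist_le_infDist_add_dist)
    (by simpa using hy.add h)

/-- If `f` is uniformly continuous on bounded sets and there is a
nondecreasing `ω : [0,∞) → [0,∞)` vanishing exactly at `0` with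
`f x + ω (dist (x, Ω)) → +∞` as `‖x‖ → +∞`, then (weak) Levitin-Polyak well-posedness
in the extended sense is equivalent to (weak) Tykhonov well-posedness in the
extended sense. -/
theorem stmt5 {X : Type*} [NormedAddCommGroup X] [NormedSpace ℝ X] (M Q : Set X)
    (f : X → EReal) (fstar : ℝ)
    (hM : M.Nonempty) (hQ : Q.Nonempty) (hfeas : (M ∩ Q).Nonempty)
    (hopt : (⨅ x ∈ M ∩ Q, f x) = (fstar : EReal))
    (hf : UnifContOnBddEReal f)
    (ω : ℝ → ℝ)
    (hωmono : MonotoneOn ω (Ici 0))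
    (hωnonneg : ∀ t : ℝ, 0 ≤ t → 0 ≤ ω t)
    (hωzero : ∀ t : ℝ, 0 ≤ t → (ω t = 0 ↔ t = 0))
    (hcoer : Tendsto (fun x : X => f x + ((ω (infDist x (M ∩ Q)) : ℝ) : EReal))
      (comap norm atTop) (𝓝 (⊤ : EReal))) :
    (LevitinPolyakWPExt M Q f fstar ↔ TykhonovWPExt M Q f fstar) ∧
      (WeakLevitinPolyakWPExt M Q f fstar ↔ WeakTykhonovWPExt M Q f fstar) := by
  have hfeasible {x : ℕ → X} (hx : ∀ n, x n ∈ M ∩ Q) :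
      Tendsto (fun n => infDist (x n) (M ∩ Q)) atTop (𝓝 0) := by
    simp only [infDist_zero_of_mem (hx _), tendsto_const_nhds]
  refine ⟨⟨fun h => ⟨h.1, fun x hx hfx => h.2 x hfx (hfeasible hx)⟩,
      fun h => ⟨h.1, fun x hfx hx => ?_⟩⟩,
    ⟨fun h => ⟨h.1, fun x hx hfx => h.2 x hfx (hfeasible hx)⟩,
      fun h => ⟨h.1, fun x hfx hx => ?_⟩⟩⟩
  all_goals
    obtain ⟨y, hy, hfy, hxy⟩ :=
      exists_feasible_minimizing_seq hfeas hopt hf hωmono hcoer hfx hx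
  · exact (h.2 y hy hfy).of_dist hxy
  · exact tendsto_infDist_zero_of_dist (h.2 y hy hfy) hxy
end
end

section
/- The problem (P) is Levitin-Polyak well-posed with respect to the infeasibility measure φ if and only if it is weakly Levitin-Polyak well-posed with respect to the infeasibility measure φ and the set argmin(P) is compact. -/
open Metric Filter Topology Set ENNReal Bornology

noncomputable section

/-- A sequence whose distance to a nonempty compact set tends to zero has a subsequence
converging to a point of this set. -/
theorem hasSubseqConvTo_of_tendsto_infDist {X : Type*} [MetricSpace X] {S : Set X}
    (hS : IsCompact S) (hne : S.Nonempty) {x : ℕ → X}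
    (hx : Tendsto (fun n => infDist (x n) S) atTop (𝓝 0)) : HasSubseqConvTo x S := by
  choose y hyS hy using fun n => hS.exists_infDist_eq_dist hne (x n)
  obtain ⟨p, hp, σ, hσ, hlim⟩ := hS.tendsto_subseq hyS
  refine ⟨σ, p, hσ, hp, (tendsto_iff_of_dist ?_).2 hlim⟩
  simpa only [Function.comp_def, hy] using hx.comp hσ.tendsto_atTop

/-- The distance to `S` tends to zero along a sequence all of whose subsequences have
a further subsequence converging to a point of `S`. -/
theorem tendsto_infDist_of_hasSubseqConvTo {X : Type*} [MetricSpace X] {S : Set X} {x : ℕ → X}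
    (hx : ∀ ns : ℕ → ℕ, Tendsto ns atTop atTop → HasSubseqConvTo (x ∘ ns) S) :
    Tendsto (fun n => infDist (x n) S) atTop (𝓝 0) := by
  refine tendsto_of_subseq_tendsto fun ns hns => ?_
  obtain ⟨σ, p, -, hp, hlim⟩ := hx ns hns
  refine ⟨σ, ?_⟩
  simpa only [infDist_zero_of_mem hp, Function.comp_def] using
    ((continuous_infDist_pt S).tendsto p).comp hlim

/-- (P) is Levitin-Polyak well-posed with respect to the infeasibility
measure `phi` iff it is weakly Levitin-Polyak well-posed with respect to `phi` and
`argmin(P)` is compact. -/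
theorem stmt6 {X : Type*} [MetricSpace X] (M Q : Set X) (f : X → EReal) (phi : X → ℝ≥0∞)
    (fstar : ℝ)
    (hM : M.Nonempty) (hQ : Q.Nonempty) (hfeas : (M ∩ Q).Nonempty)
    (hphi : IsPenaltyTerm M Q phi)
    (hopt : (⨅ x ∈ M ∩ Q, f x) = (fstar : EReal)) :
    LevitinPolyakWPwrt M Q f phi fstar ↔
      WeakLevitinPolyakWPwrt M Q f phi fstar ∧ IsCompact (argminP M Q f fstar) := by
  constructor
  · rintro ⟨hne, hLP⟩
    refine ⟨⟨hne, fun x hf hp => tendsto_infDist_of_hasSubseqConvTo fun ns hns =>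
      hLP (x ∘ ns) (hf.comp hns) (hp.comp hns)⟩, IsSeqCompact.isCompact fun x hx => ?_⟩
    have hfx : ∀ n, f (x n) = fstar := fun n => (hx n).2
    have hpx : ∀ n, phi (x n) = 0 := fun n => (hphi _ (hx n).1.2).2 (hx n).1.1
    obtain ⟨σ, p, hσ, hp, hlim⟩ := hLP x (by simp only [hfx, tendsto_const_nhds])
      (by simp only [hpx, tendsto_const_nhds])
    exact ⟨p, hp, σ, hσ, hlim⟩
  · rintro ⟨⟨hne, hW⟩, hK⟩
    exact ⟨hne, fun x hf hp => hasSubseqConvTo_of_tendsto_infDist hK hne (hW x hf hp)⟩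
end
end

section
/- Suppose there exist δ > 0 and a continuous nondecreasing function ω : [0,+∞) → [0,+∞) such that ω(t) = 0 if and only if t = 0, and φ(x) ≥ ω(dist(x, Ω)) for every x ∈ X \ Ω with φ(x) < δ. If the problem (P) is weakly Levitin-Polyak well-posed in the extended sense, then it is weakly Levitin-Polyak well-posed with respect to the infeasibility measure φ. -/
open Metric Filter Topology Set ENNReal Bornology

noncomputable section

/-- A function that is monotone on `[0, ∞)` and positive on `(0, ∞)` forces `u → 0`
whenever `ofReal (ω (u i))` is eventually dominated by a family tending to `0`. -/
theorem tendsto_zero_of_ofReal_comp_le {ι : Type*} {l : Filter ι} {ω : ℝ → ℝ} {u : ι → ℝ}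
    {g : ι → ℝ≥0∞} (hmono : MonotoneOn ω (Ici 0)) (hpos : ∀ t, 0 < t → 0 < ω t)
    (hu : ∀ i, 0 ≤ u i) (hg : Tendsto g l (𝓝 0))
    (hle : ∀ᶠ i in l, u i = 0 ∨ ENNReal.ofReal (ω (u i)) ≤ g i) :
    Tendsto u l (𝓝 0) := by
  refine tendsto_order.2 ⟨fun a ha => Eventually.of_forall fun i => ha.trans_le (hu i),
    fun ε hε => ?_⟩
  filter_upwards [hle, hg.eventually_lt_const (ENNReal.ofReal_pos.2 (hpos ε hε))] with i hi hgi
  rcases hi with hi | hi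
  · rwa [hi]
  · by_contra! hεi
    exact absurd (ENNReal.ofReal_le_ofReal (hmono hε.le (hu i) hεi)) (hi.trans_lt hgi).not_ge

/-- If `phi` admits the nonlocal error bound
`phi x ≥ ω (dist (x, Ω))` for all infeasible `x` with `phi x < δ`, where `ω` is continuous,
nondecreasing and vanishes exactly at `0`, then weak Levitin-Polyak well-posedness in the
extended sense implies weak Levitin-Polyak well-posedness with respect to `phi`. -/
theorem stmt7 {X : Type*} [MetricSpace X] (M Q : Set X) (f : X → EReal) (phi : X → ℝ≥0∞)
    (fstar : ℝ)
    (hM : M.Nonempty) (hQ : Q.Nonempty) (hfeas : (M ∩ Q).Nonempty)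
    (hphi : IsPenaltyTerm M Q phi)
    (hopt : (⨅ x ∈ M ∩ Q, f x) = (fstar : EReal))
    (δ : ℝ) (hδ : 0 < δ)
    (ω : ℝ → ℝ)
    (hωcont : ContinuousOn ω (Ici 0))
    (hωmono : MonotoneOn ω (Ici 0))
    (hωnonneg : ∀ t : ℝ, 0 ≤ t → 0 ≤ ω t)
    (hωzero : ∀ t : ℝ, 0 ≤ t → (ω t = 0 ↔ t = 0))
    (herr : ∀ x : X, x ∉ M ∩ Q → phi x < ENNReal.ofReal δ →
      ENNReal.ofReal (ω (infDist x (M ∩ Q))) ≤ phi x) :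
    WeakLevitinPolyakWPExt M Q f fstar → WeakLevitinPolyakWPwrt M Q f phi fstar := by
  rintro ⟨hne, hwp⟩
  refine ⟨hne, fun x hf hx => hwp x hf ?_⟩
  have hpos : ∀ t, 0 < t → 0 < ω t := fun t ht =>
    (hωnonneg t ht.le).lt_of_ne' fun h => ht.ne' ((hωzero t ht.le).1 h)
  refine tendsto_zero_of_ofReal_comp_le hωmono hpos (fun _ => infDist_nonneg) hx ?_
  filter_upwards [hx.eventually_lt_const (ENNReal.ofReal_pos.2 hδ)] with n hn
  by_cases hmem : x n ∈ M ∩ Q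
  · exact Or.inl (infDist_zero_of_mem hmem)
  · exact Or.inr (herr (x n) hmem hn)
end
end

section
/- Let X be a real normed space and suppose one of the following two conditions holds: (1) φ is uniformly continuous on the set { x ∈ X : dist(x, Ω) < δ } for some δ > 0; (2) φ is uniformly continuous on bounded sets and at least one of the following is satisfied: (a) the set Ω is bounded, (b) there exists a nondecreasing function η : [0,+∞) → [0,+∞) such that f(x) + η(dist(x, Ω)) → +∞ as ‖x‖ → +∞, (c) the set { x ∈ X : |f(x) − f_*| < α, dist(x, Ω) < δ } is bounded for some α > 0 and δ > 0. If the problem (P) is weakly Levitin-Polyak well-posed with respect to the infeasibility measure φ, then it is weakly Levitin-Polyak well-posed in the extended sense. -/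
open Metric Filter Topology Set ENNReal Bornology

noncomputable section

/-- `phi` is uniformly continuous on the set `s`. -/
def UnifContOnENN {X : Type*} [PseudoMetricSpace X] (phi : X → ℝ≥0∞) (s : Set X) : Prop :=
  ∀ ε : ℝ≥0∞, 0 < ε → ∃ δ > (0 : ℝ), ∀ x ∈ s, ∀ y ∈ s, dist x y < δ → phi x ≤ phi y + ε

/-- If `phi` vanishes on `S` and is uniformly continuous on a set that contains almost all terms
of `x` and the points of `S` near them, then `phi (x n) → 0` as soon as `x n` approaches `S`. -/
theorem UnifContOnENN.tendsto_zero {X : Type*} [PseudoMetricSpace X] {phi : X → ℝ≥0∞}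
    {s S : Set X} {r : ℝ} {x : ℕ → X} (hs : UnifContOnENN phi s) (hS : S.Nonempty)
    (hzero : ∀ y ∈ S, phi y = 0) (hr : 0 < r)
    (hx : ∀ᶠ n in atTop, x n ∈ s ∧ ∀ y ∈ S, dist (x n) y < r → y ∈ s)
    (hdist : Tendsto (fun n => infDist (x n) S) atTop (𝓝 0)) :
    Tendsto (fun n => phi (x n)) atTop (𝓝 0) := by
  rw [ENNReal.tendsto_nhds_zero]
  intro ε hε
  obtain ⟨δ, hδ, h⟩ := hs ε hε
  filter_upwards [hx, hdist.eventually_lt_const (lt_min hδ hr)] with n hn hd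
  obtain ⟨y, hy, hxy⟩ := (infDist_lt_iff hS).1 hd
  simpa [hzero y hy] using
    h _ hn.1 y (hn.2 y hy (hxy.trans_le (min_le_right _ _))) (hxy.trans_le (min_le_left _ _))

/-- A version of `UnifContOnENN.tendsto_zero` for eventually bounded sequences. -/
theorem tendsto_zero_of_unifContOnENN_bounded {X : Type*} [PseudoMetricSpace X] {phi : X → ℝ≥0∞}
    {B S : Set X} {x : ℕ → X} (hphi : ∀ s : Set X, IsBounded s → UnifContOnENN phi s)
    (hS : S.Nonempty) (hzero : ∀ y ∈ S, phi y = 0) (hB : IsBounded B)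
    (hx : ∀ᶠ n in atTop, x n ∈ B)
    (hdist : Tendsto (fun n => infDist (x n) S) atTop (𝓝 0)) :
    Tendsto (fun n => phi (x n)) atTop (𝓝 0) := by
  refine (hphi _ (hB.thickening (δ := 1))).tendsto_zero hS hzero one_pos ?_ hdist
  filter_upwards [hx] with n hn
  refine ⟨self_subset_thickening one_pos _ hn, fun y _ hy => ?_⟩
  exact mem_thickening_iff.2 ⟨x n, hn, by rwa [dist_comm]⟩

/-- A coercivity condition on `f + η ∘ infDist · S` bounds the sequences that approach `S` and
along which `f` is bounded above. -/
theorem exists_isBounded_of_tendsto_top {X : Type*} [SeminormedAddCommGroup X] {S : Set X}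
    {f : X → EReal} {η : ℝ → ℝ} {c : ℝ} {x : ℕ → X} (hη : MonotoneOn η (Ici 0))
    (htop : Tendsto (fun x : X => f x + ((η (infDist x S) : ℝ) : EReal))
      (comap norm atTop) (𝓝 ⊤))
    (hf : ∀ᶠ n in atTop, f (x n) ≤ c)
    (hdist : Tendsto (fun n => infDist (x n) S) atTop (𝓝 0)) :
    ∃ B : Set X, IsBounded B ∧ ∀ᶠ n in atTop, x n ∈ B := by
  have h := htop.eventually_const_lt (EReal.coe_lt_top (c + η 1))
  rw [comap_norm_atTop, eventually_iff, ← isCobounded_def, ← isBounded_compl_iff] at h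
  refine ⟨_, h, ?_⟩
  filter_upwards [hf, hdist.eventually_lt_const one_pos] with n hn hd
  simp only [mem_compl_iff, mem_ofPred_eq, not_lt, EReal.coe_add]
  exact add_le_add hn (EReal.coe_le_coe_iff.2
    (hη (mem_Ici.2 infDist_nonneg) (mem_Ici.2 zero_le_one) hd.le))

/-- Under one of two uniform continuity conditions on `phi`, weak
Levitin-Polyak well-posedness with respect to `phi` implies weak Levitin-Polyak
well-posedness in the extended sense. -/
theorem stmt9 {X : Type*} [NormedAddCommGroup X] [NormedSpace ℝ X] (M Q : Set X)
    (f : X → EReal) (phi : X → ℝ≥0∞) (fstar : ℝ)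
    (hM : M.Nonempty) (hQ : Q.Nonempty) (hfeas : (M ∩ Q).Nonempty)
    (hphi : IsPenaltyTerm M Q phi)
    (hopt : (⨅ x ∈ M ∩ Q, f x) = (fstar : EReal))
    (hcond :
      (∃ δ : ℝ, 0 < δ ∧ UnifContOnENN phi {x : X | infDist x (M ∩ Q) < δ}) ∨
      ((∀ s : Set X, IsBounded s → UnifContOnENN phi s) ∧
        (IsBounded (M ∩ Q) ∨
          (∃ η : ℝ → ℝ, MonotoneOn η (Ici 0) ∧ (∀ t : ℝ, 0 ≤ t → 0 ≤ η t) ∧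
            Tendsto (fun x : X => f x + ((η (infDist x (M ∩ Q)) : ℝ) : EReal))
              (comap norm atTop) (𝓝 (⊤ : EReal))) ∨
          (∃ α δ : ℝ, 0 < α ∧ 0 < δ ∧
            IsBounded {x : X | ((fstar - α : ℝ) : EReal) < f x ∧
              f x < ((fstar + α : ℝ) : EReal) ∧ infDist x (M ∩ Q) < δ})))) :
    WeakLevitinPolyakWPwrt M Q f phi fstar → WeakLevitinPolyakWPExt M Q f fstar := by
  rintro ⟨hne, hwp⟩
  refine ⟨hne, fun x hf hdist => hwp x hf ?_⟩
  have hzero : ∀ y ∈ M ∩ Q, phi y = 0 := fun y hy => (hphi y hy.2).2 hy.1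
  rcases hcond with ⟨δ, hδ, hunif⟩ | ⟨hunif, hbdd⟩
  · refine hunif.tendsto_zero hfeas hzero one_pos ?_ hdist
    filter_upwards [hdist.eventually_lt_const hδ] with n hn
    exact ⟨hn, fun y hy _ => by simpa [infDist_zero_of_mem hy] using hδ⟩
  · have hupper : ∀ α : ℝ, 0 < α → ∀ᶠ n in atTop, f (x n) < ((fstar + α : ℝ) : EReal) :=
      fun α hα => hf.eventually_lt_const (EReal.coe_lt_coe_iff.2 (by linarith))
    obtain ⟨B, hB, hx⟩ : ∃ B : Set X, IsBounded B ∧ ∀ᶠ n in atTop, x n ∈ B := by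
      rcases hbdd with hΩ | ⟨η, hη, -, htop⟩ | ⟨α, δ, hα, hδ, hb⟩
      · refine ⟨_, hΩ.thickening (δ := 1), ?_⟩
        filter_upwards [hdist.eventually_lt_const one_pos] with n hn
        exact mem_thickening_iff.2 ((infDist_lt_iff hfeas).1 hn)
      · exact exists_isBounded_of_tendsto_top hη htop
          ((hupper 1 one_pos).mono fun _ => le_of_lt) hdist
      · refine ⟨_, hb, ?_⟩
        filter_upwards [hf.eventually_const_lt (EReal.coe_lt_coe_iff.2 (sub_lt_self fstar hα)),
          hupper α hα, hdist.eventually_lt_const hδ] with n h₁ h₂ h₃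
        exact ⟨h₁, h₂, h₃⟩
    exact tendsto_zero_of_unifContOnENN_bounded hunif hfeas hzero hB hx hdist
end
end

section
/- Let a sequence {ε_n} ⊆ [0,+∞) and a non-decreasing sequence {c_n} ⊆ (0,+∞) be such that ε_n → 0 and c_n → +∞ as n → ∞, and suppose the function F_{c_0} (with c_0 the first element of the sequence {c_n}) is bounded below on Q. Then for any sequence {x_n} ⊆ Q of ε_n-minimizers of F_{c_n} on Q, i.e. F_{c_n}(x_n) ≤ inf_{x∈Q} F_{c_n}(x) + ε_n for all n, one has φ(x_n) → 0 as n → ∞ and min{ liminf_{p↓0} β_φ(p), f_* } ≤ liminf_{n→∞} f(x_n) ≤ limsup_{n→∞} f(x_n) ≤ f_*, where p ↓ 0 means p approaches 0 from the right. -/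
open Metric Filter Topology Set ENNReal Bornology

noncomputable section

/-- The optimal value function `β_φ(p) = inf { f x : x ∈ Q, phi x ≤ p }`. -/
def betaPhi {X : Type*} (Q : Set X) (f : X → EReal) (phi : X → ℝ≥0∞) (p : ℝ≥0∞) : EReal :=
  ⨅ x ∈ {x : X | x ∈ Q ∧ phi x ≤ p}, f x

/-- Where the penalty function lies between two real numbers (for a possibly larger parameter
above), the objective and the penalty term are both finite. -/
theorem exists_real_of_pen_bounds {X : Type*} {f : X → EReal} {phi : X → ℝ≥0∞} {c₀ c b B : ℝ}
    {x : X} (hc : 0 < c) (hb : (b : EReal) ≤ Pen f phi c₀ x) (hB : Pen f phi c x ≤ (B : EReal)) :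
    ∃ F p : ℝ, 0 ≤ p ∧ f x = (F : EReal) ∧ phi x = ENNReal.ofReal p ∧
      b ≤ F + c₀ * p ∧ F + c * p ≤ B := by
  unfold Pen at hb hB
  have hf_bot : f x ≠ ⊥ := by
    intro h
    simp [h] at hb
  have hphi_top : phi x ≠ ⊤ := by
    intro h
    rw [h, EReal.coe_ennreal_top, EReal.coe_mul_top_of_pos hc, EReal.add_top_of_ne_bot hf_bot] at hB
    simp at hB
  have hp : phi x = ENNReal.ofReal (phi x).toReal := (ENNReal.ofReal_toReal hphi_top).symm
  have hp' : ((phi x : ℝ≥0∞) : EReal) = ((phi x).toReal : EReal) :=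
    (EReal.coe_toReal (by simpa using hphi_top) (by simp)).symm.trans (by simp)
  rw [hp', ← EReal.coe_mul] at hb hB
  have hf_top : f x ≠ ⊤ := by
    intro h
    rw [h, EReal.top_add_coe] at hB
    simp at hB
  have hf : f x = ((f x).toReal : EReal) := (EReal.coe_toReal hf_top hf_bot).symm
  rw [hf, ← EReal.coe_add] at hb hB
  exact ⟨_, _, ENNReal.toReal_nonneg, hf, hp, EReal.coe_le_coe_iff.1 hb, EReal.coe_le_coe_iff.1 hB⟩

/-- The infimum of the penalty function does not exceed the optimal value. -/
theorem iInf_pen_le_iInf {X : Type*} {M Q : Set X} {f : X → EReal} {phi : X → ℝ≥0∞}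
    (hphi : IsPenaltyTerm M Q phi) (c : ℝ) :
    (⨅ y ∈ Q, Pen f phi c y) ≤ ⨅ x ∈ M ∩ Q, f x := by
  refine le_iInf₂ fun y hy => (iInf₂_le y hy.2).trans ?_
  simp [Pen, (hphi y hy.2).2 hy.1]

/-- Behaviour of approximate minimizers of the penalty functions
`F_{c_n}` as `c_n → +∞`. -/
theorem stmt10 {X : Type*} [MetricSpace X] (M Q : Set X) (f : X → EReal) (phi : X → ℝ≥0∞)
    (fstar : ℝ)
    (hM : M.Nonempty) (hQ : Q.Nonempty) (hfeas : (M ∩ Q).Nonempty)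
    (hphi : IsPenaltyTerm M Q phi)
    (hopt : (⨅ x ∈ M ∩ Q, f x) = (fstar : EReal))
    (ε : ℕ → ℝ) (hεnonneg : ∀ n, 0 ≤ ε n) (hε : Tendsto ε atTop (𝓝 0))
    (c : ℕ → ℝ) (hcpos : ∀ n, 0 < c n) (hcmono : Monotone c)
    (hc : Tendsto c atTop atTop)
    (hbdd : ∃ b : ℝ, ∀ x ∈ Q, (b : EReal) ≤ Pen f phi (c 0) x)
    (x : ℕ → X) (hxQ : ∀ n, x n ∈ Q)
    (hxmin : ∀ n, Pen f phi (c n) (x n) ≤ (⨅ y ∈ Q, Pen f phi (c n) y) + ((ε n : ℝ) : EReal)) :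
    Tendsto (fun n => phi (x n)) atTop (𝓝 (0 : ℝ≥0∞)) ∧
      min (Filter.liminf (betaPhi Q f phi) (𝓝[>] (0 : ℝ≥0∞))) (fstar : EReal) ≤
        Filter.liminf (fun n => f (x n)) atTop ∧
      Filter.liminf (fun n => f (x n)) atTop ≤ Filter.limsup (fun n => f (x n)) atTop ∧
      Filter.limsup (fun n => f (x n)) atTop ≤ (fstar : EReal) := by
  obtain ⟨b, hb⟩ := hbdd
  have hupper (n : ℕ) : Pen f phi (c n) (x n) ≤ ((fstar + ε n : ℝ) : EReal) := by
    rw [EReal.coe_add, ← hopt]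
    exact (hxmin n).trans (add_le_add_left (iInf_pen_le_iInf hphi (c n)) _)
  choose F p hp hF hphix hlow hupp using
    fun n => exists_real_of_pen_bounds (hcpos n) (hb (x n) (hxQ n)) (hupper n)
  have hp_lim : Tendsto p atTop (𝓝 0) := by
    have hc' : Tendsto (fun n => c n - c 0) atTop atTop :=
      tendsto_atTop_add_const_right _ _ hc
    have hquot : Tendsto (fun n => (fstar + ε n - b) / (c n - c 0)) atTop (𝓝 0) :=
      ((tendsto_const_nhds.add hε).sub tendsto_const_nhds).div_atTop hc'
    refine squeeze_zero' (Eventually.of_forall hp) ?_ hquot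
    filter_upwards [hc'.eventually_gt_atTop 0] with n hn
    rw [le_div_iff₀ hn]
    nlinarith [hlow n, hupp n]
  have hphi_lim : Tendsto (fun n => phi (x n)) atTop (𝓝 (0 : ℝ≥0∞)) := by
    simp only [hphix]
    simpa using ENNReal.tendsto_ofReal hp_lim
  refine ⟨hphi_lim, ?_, liminf_le_limsup, ?_⟩
  · refine le_of_forall_lt fun a ha => ?_
    obtain ⟨a', haa', ha'⟩ := exists_between ha
    rw [lt_min_iff] at ha'
    refine haa'.trans_le (le_liminf_of_le (by isBoundedDefault) ?_)
    have hev := eventually_lt_of_lt_liminf ha'.1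
    rw [eventually_nhdsWithin_iff] at hev
    filter_upwards [hphi_lim.eventually hev] with n hn
    by_cases h0 : phi (x n) = 0
    · refine ha'.2.le.trans (hopt.symm.le.trans ?_)
      exact iInf₂_le (x n) ⟨(hphi _ (hxQ n)).1 h0, hxQ n⟩
    · exact (hn (pos_iff_ne_zero.2 h0)).le.trans (iInf₂_le (x n) ⟨hxQ n, le_rfl⟩)
  · have hlim : Tendsto (fun n => ((fstar + ε n : ℝ) : EReal)) atTop (𝓝 (fstar : EReal)) := by
      refine (continuous_coe_real_ereal.tendsto _).comp ?_
      simpa using tendsto_const_nhds.add hε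
    rw [← hlim.limsup_eq]
    refine limsup_le_limsup (Eventually.of_forall fun n => ?_)
    simp only [hF]
    exact EReal.coe_le_coe_iff.2 (by nlinarith [hupp n, mul_nonneg (hcpos n).le (hp n)])
end
end

section
/- Let the problem (P) be weakly Levitin-Polyak well-posed with respect to the infeasibility measure φ. Then the penalty function F_c is globally exact if and only if the following three conditions hold: (1) F_c has the zero duality gap property; (2) there exists c_0 ≥ 0 such that F_c attains a global minimum on Q for every c ≥ c_0; (3) F_c is uniformly locally exact at globally optimal solutions of (P). -/
open Metric Filter Topology Set ENNReal Bornology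

noncomputable section

/-- `F` attains a global minimum on `Q`. -/
def AttainsGlobMin {X : Type*} (F : X → EReal) (Q : Set X) : Prop :=
  ∃ x ∈ Q, ∀ y ∈ Q, F x ≤ F y

/-- The penalty function `F_c` is globally exact: for all sufficiently large `c ≥ 0`
the set of global minimizers of `F_c` on `Q` coincides with `argminP`. -/
def GloballyExactPen {X : Type*} (M Q : Set X) (f : X → EReal) (phi : X → ℝ≥0∞)
    (fstar : ℝ) : Prop :=
  ∃ cs : ℝ, 0 ≤ cs ∧ ∀ c ≥ cs,
    {x | x ∈ Q ∧ ∀ y ∈ Q, Pen f phi c x ≤ Pen f phi c y} = argminP M Q f fstar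

/-- The zero duality gap property: `sup_{c ≥ 0} inf_{x ∈ Q} F_c x = fstar`. -/
def ZeroDualityGap {X : Type*} (Q : Set X) (f : X → EReal) (phi : X → ℝ≥0∞) (fstar : ℝ) :
    Prop :=
  (⨆ c : ℝ, ⨆ _ : (0 : ℝ) ≤ c, ⨅ x ∈ Q, Pen f phi c x) = (fstar : EReal)

/-- `x₀` is a local minimizer of `F` on `Q`. -/
def IsLocalMinOnSet {X : Type*} [MetricSpace X] (F : X → EReal) (Q : Set X) (x₀ : X) : Prop :=
  ∃ r > (0 : ℝ), ∀ x ∈ Q, dist x x₀ ≤ r → F x₀ ≤ F x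

/-- The penalty function `F_c` is locally exact at `x₀`. -/
def LocallyExactAt {X : Type*} [MetricSpace X] (f : X → EReal) (phi : X → ℝ≥0∞)
    (Q : Set X) (x₀ : X) : Prop :=
  ∃ cs : ℝ, 0 ≤ cs ∧ ∀ c ≥ cs, IsLocalMinOnSet (Pen f phi c) Q x₀

/-- The least exact penalty parameter `c_*(x₀)` at `x₀`. -/
def penCStarAt {X : Type*} [MetricSpace X] (f : X → EReal) (phi : X → ℝ≥0∞)
    (Q : Set X) (x₀ : X) : ℝ :=
  sInf {cs : ℝ | 0 ≤ cs ∧ ∀ c ≥ cs, IsLocalMinOnSet (Pen f phi c) Q x₀}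

/-- The radius of local exactness `r_*(x₀, cs)`: the supremum of all `r > 0` such that
`F_c x ≥ F_c x₀` for every `x ∈ B(x₀, r) ∩ Q` and every `c ≥ cs` (as an extended real). -/
def penRadiusAt {X : Type*} [MetricSpace X] (f : X → EReal) (phi : X → ℝ≥0∞)
    (Q : Set X) (x₀ : X) (cs : ℝ) : EReal :=
  sSup (Real.toEReal ''
    {r : ℝ | 0 < r ∧ ∀ c ≥ cs, ∀ x ∈ Q, dist x x₀ ≤ r → Pen f phi c x₀ ≤ Pen f phi c x})

/-- `F_c` is uniformly locally exact at globally optimal solutions of (P). -/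
def UniformlyLocallyExact {X : Type*} [MetricSpace X] (M Q : Set X) (f : X → EReal)
    (phi : X → ℝ≥0∞) (fstar : ℝ) : Prop :=
  (∀ x₀ ∈ argminP M Q f fstar, LocallyExactAt f phi Q x₀) ∧
    ∃ cs rs : ℝ, 0 < cs ∧ 0 < rs ∧
      ∀ x₀ ∈ argminP M Q f fstar,
        penCStarAt f phi Q x₀ < cs ∧ (rs : EReal) ≤ penRadiusAt f phi Q x₀ cs

/-- `F_c` is non-degenerate in the extended sense. -/
def NondegenerateExt {X : Type*} [MetricSpace X] (M Q : Set X) (f : X → EReal)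
    (phi : X → ℝ≥0∞) : Prop :=
  ∃ cs : ℝ, 0 ≤ cs ∧ ∃ xc : ℝ → X,
    (∀ c ≥ cs, xc c ∈ Q ∧ ∀ y ∈ Q, Pen f phi c (xc c) ≤ Pen f phi c y) ∧
    Tendsto (fun c => infDist (xc c) (M ∩ Q)) atTop (𝓝 0)

theorem pen_eq_of_mem {X : Type*} {M Q : Set X} {f : X → EReal} {phi : X → ℝ≥0∞} {fstar : ℝ}
    (hphi : IsPenaltyTerm M Q phi) {x : X} (hx : x ∈ argminP M Q f fstar) (c : ℝ) :
    Pen f phi c x = fstar := by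
  simp [Pen, (hphi x hx.1.2).2 hx.1.1, hx.2]

/-- Where the penalty function is bounded above and `f` is not `-∞`, both terms are finite. -/
theorem exists_real_of_pen_le {X : Type*} {f : X → EReal} {phi : X → ℝ≥0∞} {b c : ℝ} {x : X}
    (hc : 0 < c) (hbot : f x ≠ ⊥) (hle : Pen f phi c x ≤ b) :
    ∃ a p : ℝ, 0 ≤ p ∧ f x = a ∧ phi x = ENNReal.ofReal p ∧
      ∀ c' : ℝ, Pen f phi c' x = ((a + c' * p : ℝ) : EReal) := by
  have hnn : (0 : EReal) ≤ (c : EReal) * (phi x : EReal) :=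
    mul_nonneg (by exact_mod_cast hc.le) (EReal.coe_ennreal_nonneg _)
  have htop : phi x ≠ ⊤ := by
    intro h
    rw [Pen, h, EReal.coe_ennreal_top, EReal.coe_mul_top_of_pos hc,
      EReal.add_top_of_ne_bot hbot] at hle
    exact EReal.coe_ne_top b (top_le_iff.1 hle)
  have hftop : f x ≠ ⊤ := by
    intro h
    rw [Pen, h, EReal.top_add_of_ne_bot (ne_bot_of_le_ne_bot (by simp) hnn)] at hle
    exact EReal.coe_ne_top b (top_le_iff.1 hle)
  have hf : f x = ((f x).toReal : EReal) := (EReal.coe_toReal hftop hbot).symm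
  have hp : (phi x : EReal) = ((phi x).toReal : EReal) :=
    (EReal.coe_ennreal_toReal htop).symm
  refine ⟨(f x).toReal, (phi x).toReal, ENNReal.toReal_nonneg, hf,
    (ENNReal.ofReal_toReal htop).symm, fun c' => ?_⟩
  rw [Pen, hp, EReal.coe_add, EReal.coe_mul, ← hf]

theorem pen_mono {X : Type*} (f : X → EReal) (phi : X → ℝ≥0∞) (x : X) :
    Monotone fun c => Pen f phi c x := fun c d h => by
  exact add_le_add_right
    (mul_le_mul_of_nonneg_right (by exact_mod_cast h) (EReal.coe_ennreal_nonneg _)) (f x)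

theorem ZeroDualityGap.exists_le_pen {X : Type*} {Q : Set X} {f : X → EReal} {phi : X → ℝ≥0∞}
    {fstar b : ℝ} (h : ZeroDualityGap Q f phi fstar) (hb : b < fstar) :
    ∃ c : ℝ, 0 ≤ c ∧ ∀ x ∈ Q, (b : EReal) ≤ Pen f phi c x := by
  have hlt : (b : EReal) < ⨆ c : ℝ, ⨆ _ : (0 : ℝ) ≤ c, ⨅ x ∈ Q, Pen f phi c x := by
    rw [ZeroDualityGap] at h
    rw [h]
    exact_mod_cast hb
  simp only [lt_iSup_iff] at hlt
  obtain ⟨c, hc, hlt⟩ := hlt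
  exact ⟨c, hc, fun x hx => hlt.le.trans (iInf₂_le x hx)⟩

theorem ZeroDualityGap.ne_bot {X : Type*} {Q : Set X} {f : X → EReal} {phi : X → ℝ≥0∞}
    {fstar : ℝ} (h : ZeroDualityGap Q f phi fstar) {x : X} (hx : x ∈ Q) : f x ≠ ⊥ := by
  obtain ⟨c, -, hc⟩ := h.exists_le_pen (sub_one_lt fstar)
  intro hf
  have := hc x hx
  rw [Pen, hf, EReal.bot_add] at this
  exact EReal.coe_ne_bot _ (le_bot_iff.1 this)

/-- Under zero duality gap, minimizers of `F_c` form a minimizing sequence as `c → ∞`. -/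
theorem ZeroDualityGap.tendsto_minimizers {X : Type*} {Q : Set X} {f : X → EReal}
    {phi : X → ℝ≥0∞} {fstar : ℝ} (h : ZeroDualityGap Q f phi fstar) {c : ℕ → ℝ}
    (hc : ∀ n, 0 < c n) (hct : Tendsto c atTop atTop) {x : ℕ → X} (hx : ∀ n, x n ∈ Q)
    (hle : ∀ n, Pen f phi (c n) (x n) ≤ fstar) :
    Tendsto (fun n => f (x n)) atTop (𝓝 (fstar : EReal)) ∧
      Tendsto (fun n => phi (x n)) atTop (𝓝 (0 : ℝ≥0∞)) := by
  choose a p hp hfa hphip hpen using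
    fun n => exists_real_of_pen_le (hc n) (h.ne_bot (hx n)) (hle n)
  have hle' : ∀ n, a n + c n * p n ≤ fstar := fun n => by
    have := hle n
    rw [hpen] at this
    exact_mod_cast this
  have key : ∀ ε > 0, ∀ᶠ n in atTop, p n ≤ ε ∧ fstar - 2 * ε ≤ a n ∧ a n ≤ fstar := by
    intro ε hε
    obtain ⟨c₁, hc₁, hlow⟩ := h.exists_le_pen (sub_lt_self fstar hε)
    filter_upwards [hct.eventually_ge_atTop (2 * c₁ + 1)] with n hn
    have hlow' : fstar - ε ≤ a n + c₁ * p n := by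
      have := hlow (x n) (hx n)
      rw [hpen] at this
      exact_mod_cast this
    have h1 := hle' n
    have h2 := mul_le_mul_of_nonneg_right hn (hp n)
    have h3 := mul_nonneg hc₁ (hp n)
    have h4 := mul_nonneg (hc n).le (hp n)
    have h5 := hp n
    refine ⟨?_, ?_, ?_⟩ <;> nlinarith
  have ha : Tendsto a atTop (𝓝 fstar) := by
    rw [Metric.tendsto_nhds]
    intro ε hε
    filter_upwards [key (ε / 3) (by positivity)] with n hn
    rw [Real.dist_eq, abs_lt]
    constructor <;> linarith [hn.2.1, hn.2.2]
  have hp0 : Tendsto p atTop (𝓝 0) := by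
    rw [Metric.tendsto_nhds]
    intro ε hε
    filter_upwards [key (ε / 2) (by positivity)] with n hn
    rw [Real.dist_eq, sub_zero, abs_of_nonneg (hp n)]
    linarith [hn.1]
  constructor
  · simp only [hfa]
    exact (continuous_coe_real_ereal.tendsto fstar).comp ha
  · simp only [hphip]
    simpa using ENNReal.tendsto_ofReal hp0

theorem GloballyExactPen.exists_le_pen {X : Type*} {M Q : Set X} {f : X → EReal}
    {phi : X → ℝ≥0∞} {fstar : ℝ} (hphi : IsPenaltyTerm M Q phi)
    (hne : (argminP M Q f fstar).Nonempty) (h : GloballyExactPen M Q f phi fstar) :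
    ∃ cs : ℝ, 0 ≤ cs ∧ ∀ c ≥ cs, ∀ y ∈ Q, (fstar : EReal) ≤ Pen f phi c y := by
  obtain ⟨cs, hcs, h⟩ := h
  obtain ⟨z, hz⟩ := hne
  refine ⟨cs, hcs, fun c hc y hy => ?_⟩
  rw [← pen_eq_of_mem hphi hz c]
  exact ((h c hc).ge hz).2 y hy

/-- A uniform lower bound `f_* ≤ F_{c₁}` on `Q` already yields global exactness. -/
theorem globallyExactPen_of_le_pen {X : Type*} {M Q : Set X} {f : X → EReal}
    {phi : X → ℝ≥0∞} {fstar : ℝ} (hphi : IsPenaltyTerm M Q phi)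
    (hne : (argminP M Q f fstar).Nonempty) {c₁ : ℝ} (hc₁ : 0 ≤ c₁)
    (hlow : ∀ y ∈ Q, (fstar : EReal) ≤ Pen f phi c₁ y) :
    GloballyExactPen M Q f phi fstar := by
  obtain ⟨z, hz⟩ := hne
  refine ⟨c₁ + 1, by linarith, fun c hc => Set.Subset.antisymm ?_ ?_⟩
  · rintro x ⟨hx, hmin⟩
    have hle : Pen f phi c x ≤ fstar := (hmin z hz.1.2).trans_eq (pen_eq_of_mem hphi hz c)
    have hbot : f x ≠ ⊥ := by
      intro hf
      have := hlow x hx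
      rw [Pen, hf, EReal.bot_add] at this
      exact EReal.coe_ne_bot _ (le_bot_iff.1 this)
    obtain ⟨a, p, hp, hfa, hphip, hpen⟩ :=
      exists_real_of_pen_le (by linarith : 0 < c) hbot hle
    have h1 := hlow x hx
    rw [hpen] at h1 hle
    have h1 : fstar ≤ a + c₁ * p := by exact_mod_cast h1
    have h2 : a + c * p ≤ fstar := by exact_mod_cast hle
    have hp0 : p = 0 := by nlinarith [mul_le_mul_of_nonneg_right hc hp]
    subst hp0
    have haf : a = fstar := by linarith
    exact ⟨⟨(hphi x hx).1 (by simpa using hphip), hx⟩, by rw [hfa, haf]⟩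
  · intro x hx
    refine ⟨hx.1.2, fun y hy => ?_⟩
    rw [pen_eq_of_mem hphi hx c]
    exact (hlow y hy).trans (pen_mono f phi y (by linarith))

/-- For a problem weakly Levitin-Polyak well-posed with respect to
`phi`, the penalty function is globally exact iff it has the zero duality gap property,
attains a global minimum on `Q` for all sufficiently large `c`, and is uniformly locally
exact at globally optimal solutions. -/
theorem stmt11 {X : Type*} [MetricSpace X] (M Q : Set X) (f : X → EReal) (phi : X → ℝ≥0∞)
    (fstar : ℝ)
    (hM : M.Nonempty) (hQ : Q.Nonempty) (hfeas : (M ∩ Q).Nonempty)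
    (hphi : IsPenaltyTerm M Q phi)
    (hopt : (⨅ x ∈ M ∩ Q, f x) = (fstar : EReal))
    (hwp : WeakLevitinPolyakWPwrt M Q f phi fstar) :
    GloballyExactPen M Q f phi fstar ↔
      ZeroDualityGap Q f phi fstar ∧
        (∃ c₀ : ℝ, 0 ≤ c₀ ∧ ∀ c ≥ c₀, AttainsGlobMin (Pen f phi c) Q) ∧
        UniformlyLocallyExact M Q f phi fstar := by
  have hne := hwp.1
  constructor
  · intro h
    obtain ⟨cs, hcs, hlow⟩ := h.exists_le_pen hphi hne
    obtain ⟨z, hz⟩ := hne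
    have hmin : ∀ x₀ ∈ argminP M Q f fstar, ∀ c ≥ cs, ∀ y ∈ Q,
        Pen f phi c x₀ ≤ Pen f phi c y := fun x₀ hx₀ c hc y hy =>
      (pen_eq_of_mem hphi hx₀ c).trans_le (hlow c hc y hy)
    have hloc : ∀ x₀ ∈ argminP M Q f fstar, ∀ c ≥ cs, IsLocalMinOnSet (Pen f phi c) Q x₀ :=
      fun x₀ hx₀ c hc => ⟨1, one_pos, fun y hy _ => hmin x₀ hx₀ c hc y hy⟩
    refine ⟨le_antisymm ?_ ?_, ⟨cs, hcs, fun c hc => ⟨z, hz.1.2, hmin z hz c hc⟩⟩,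
      fun x₀ hx₀ => ⟨cs, hcs, hloc x₀ hx₀⟩, cs + 1, 1, by linarith, one_pos,
      fun x₀ hx₀ => ⟨?_, ?_⟩⟩
    · exact iSup₂_le fun c _ => (iInf₂_le z hz.1.2).trans_eq (pen_eq_of_mem hphi hz c)
    · exact (le_iInf₂ (hlow cs le_rfl)).trans
        (le_iSup₂ (f := fun (c : ℝ) (_ : 0 ≤ c) => ⨅ x ∈ Q, Pen f phi c x) cs hcs)
    · have hle : penCStarAt f phi Q x₀ ≤ cs :=
        csInf_le ⟨0, fun _ hc => hc.1⟩ ⟨hcs, hloc x₀ hx₀⟩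
      linarith
    · exact le_sSup ⟨1, ⟨one_pos, fun c hc y hy _ => hmin x₀ hx₀ c (by linarith) y hy⟩, rfl⟩
  · rintro ⟨hgap, ⟨c₀, hc₀, hatt⟩, -, cs, rs, hcs, hrs, hrad⟩
    have hcn : ∀ n : ℕ, c₀ ≤ n + c₀ + 1 := fun n => by
      have : (0 : ℝ) ≤ n := n.cast_nonneg
      linarith
    choose x hxQ hxmin using fun n : ℕ => hatt (n + c₀ + 1) (hcn n)
    have hct : Tendsto (fun n : ℕ => (n : ℝ) + c₀ + 1) atTop atTop :=
      tendsto_atTop_add_const_right _ _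
        (tendsto_atTop_add_const_right _ _ tendsto_natCast_atTop_atTop)
    obtain ⟨z, hz⟩ := hne
    obtain ⟨hf, hp⟩ := hgap.tendsto_minimizers (fun n => by positivity) hct hxQ
      (fun n => (hxmin n z hz.1.2).trans_eq (pen_eq_of_mem hphi hz _))
    obtain ⟨n, hdist, hn⟩ := (((hwp.2 x hf hp).eventually_lt_const
      (half_pos hrs)).and (hct.eventually_ge_atTop cs)).exists
    obtain ⟨w, hw, hwx⟩ := (infDist_lt_iff ⟨z, hz⟩).1 hdist
    have hlt : ((rs / 2 : ℝ) : EReal) < penRadiusAt f phi Q w cs :=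
      lt_of_lt_of_le (by exact_mod_cast half_lt_self hrs) (hrad w hw).2
    obtain ⟨_, ⟨r, ⟨-, hr⟩, rfl⟩, hr'⟩ := lt_sSup_iff.1 hlt
    have hr' : rs / 2 < r := by exact_mod_cast hr'
    have hle := hr _ hn (x n) (hxQ n) (hwx.le.trans hr'.le)
    rw [pen_eq_of_mem hphi hw] at hle
    exact globallyExactPen_of_le_pen hphi ⟨z, hz⟩ (hc₀.trans (hcn n))
      fun y hy => hle.trans (hxmin n y hy)
end
end
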